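/- Let E = EuclideanSpace ℝ (Fin n), let U ⊆ E be open with S := frontier U nonempty, and let W₁, W₂ ⊆ E × E be open sets with (x, 0) ∈ W₁ for every x ∈ E. Suppose φ, ψ : E × E → E × E are smooth maps (ContDiff ℝ ⊤) such that ψ ∘ φ agrees with the identity on W₁, φ ∘ ψ agrees with the identity on W₂, φ '' W₁ = W₂, φ (x, 0) = (x, x) for every x ∈ E, and φ '' (W₁ ∩ (S ×ˢ Set.univ)) = W₂ ∩ ((S ×ˢ Set.univ) ∪ (Set.univ ×ˢ S)). Then a contradiction follows (no such data exist). -/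

import Mathlib

theorem stmt9 {n : ℕ} (U : Set (EuclideanSpace ℝ (Fin n))) (hU : IsOpen U)
    (S : Set (EuclideanSpace ℝ (Fin n))) (hS : S = frontier U) (hSne : S.Nonempty)
    (W₁ W₂ : Set (EuclideanSpace ℝ (Fin n) × EuclideanSpace ℝ (Fin n)))
    (hW₁ : IsOpen W₁) (hW₂ : IsOpen W₂)
    (hzero : ∀ x : EuclideanSpace ℝ (Fin n), (x, (0 : EuclideanSpace ℝ (Fin n))) ∈ W₁)
    (φ ψ : EuclideanSpace ℝ (Fin n) × EuclideanSpace ℝ (Fin n) →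
      EuclideanSpace ℝ (Fin n) × EuclideanSpace ℝ (Fin n))
    (hφ : ContDiff ℝ (⊤ : ℕ∞) φ) (hψ : ContDiff ℝ (⊤ : ℕ∞) ψ)
    (hψφ : ∀ p ∈ W₁, ψ (φ p) = p) (hφψ : ∀ p ∈ W₂, φ (ψ p) = p)
    (himg : φ '' W₁ = W₂)
    (hdiag : ∀ x : EuclideanSpace ℝ (Fin n), φ (x, 0) = (x, x))
    (hsing : φ '' (W₁ ∩ (S ×ˢ (Set.univ : Set (EuclideanSpace ℝ (Fin n)))))
      = W₂ ∩ ((S ×ˢ (Set.univ : Set (EuclideanSpace ℝ (Fin n))))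
          ∪ ((Set.univ : Set (EuclideanSpace ℝ (Fin n))) ×ˢ S))) :
    False := by
  have hScl : IsClosed S := hS ▸ isClosed_frontier
  have hUne : U.Nonempty := by
    by_contra h
    rw [Set.not_nonempty_iff_eq_empty] at h
    subst h
    simp [hS] at hSne
  obtain ⟨u, hu⟩ := hUne
  obtain ⟨s, hsS, hs⟩ := hScl.exists_infDist_eq_dist hSne u
  have hmin : ∀ t ∈ S, ‖s - u‖ ≤ ‖t - u‖ := by
    intro t ht
    have h := Metric.infDist_le_dist_of_mem (x := u) ht
    rw [hs, dist_comm, dist_comm u t, dist_eq_norm, dist_eq_norm] at h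
    exact h
  have hsu : s - u ≠ 0 := by
    intro h
    have h1 : s = u := sub_eq_zero.mp h
    subst h1
    rw [hS, hU.frontier_eq] at hsS
    exact hsS.2 hu
  have hψd : ∀ x, ψ (x, x) = (x, 0) := fun x => by
    rw [← hdiag x]; exact hψφ _ (hzero x)
  have hsW : (s, s) ∈ W₂ := by
    rw [← himg, ← hdiag s]; exact Set.mem_image_of_mem _ (hzero s)
  have hmem : ∀ p ∈ W₂, (p.1 ∈ S ∨ p.2 ∈ S) → (ψ p).1 ∈ S := by
    intro p hp h
    have h2 : p ∈ φ '' (W₁ ∩ (S ×ˢ Set.univ)) := by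
      rw [hsing]
      refine ⟨hp, ?_⟩
      simpa using h
    obtain ⟨q, ⟨hq1, hq2⟩, rfl⟩ := h2
    rw [hψφ q hq1]
    exact hq2.1
  have hψdiff : DifferentiableAt ℝ ψ (s, s) := (hψ.differentiable (by simp)) _
  set g : EuclideanSpace ℝ (Fin n) × EuclideanSpace ℝ (Fin n) → ℝ :=
    fun p => ‖(ψ p).1 - u‖ ^ 2 with hg
  have hgd : DifferentiableAt ℝ g (s, s) := (hψdiff.fst.sub_const u).norm_sq ℝ
  have key : ∀ w : EuclideanSpace ℝ (Fin n) × EuclideanSpace ℝ (Fin n),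
      HasDerivAt (fun t : ℝ => g ((s, s) + t • w)) (fderiv ℝ g (s, s) w) 0 := by
    intro w
    have h1 : HasDerivAt (fun t : ℝ => (s, s) + t • w) w 0 := by
      simpa using ((hasDerivAt_id (0 : ℝ)).smul_const w).const_add (s, s)
    have h2 : HasFDerivAt g (fderiv ℝ g (s, s)) ((s, s) + (0 : ℝ) • w) := by
      simpa using hgd.hasFDerivAt
    exact h2.comp_hasDerivAt (0 : ℝ) h1
  have hz : ∀ w : EuclideanSpace ℝ (Fin n) × EuclideanSpace ℝ (Fin n),
      (w.1 = 0 ∨ w.2 = 0) → fderiv ℝ g (s, s) w = 0 := by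
    intro w hw
    refine IsLocalMin.hasDerivAt_eq_zero ?_ (key w)
    have hc : ContinuousAt (fun t : ℝ => (s, s) + t • w) 0 := by fun_prop
    have hev := hc.eventually_mem (hW₂.mem_nhds (by simpa using hsW))
    filter_upwards [hev] with t ht
    have := hmin _ (hmem _ ht (by rcases hw with h | h <;> simp [h, hsS]))
    simp only [hg, zero_smul, add_zero, hψd]
    gcongr
  have hd : fderiv ℝ g (s, s) (s - u, s - u) = 0 := by
    have : (s - u, s - u) = (s - u, (0 : EuclideanSpace ℝ (Fin n))) + (0, s - u) := by simp
    rw [this, map_add, hz _ (Or.inr rfl), hz _ (Or.inl rfl), add_zero]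
  have h3 := key (s - u, s - u)
  rw [hd] at h3
  have h4 : (fun t : ℝ => g ((s, s) + t • (s - u, s - u)))
      = fun t : ℝ => (1 + t) ^ 2 * ‖s - u‖ ^ 2 := by
    funext t
    have : (s, s) + t • (s - u, s - u) = (s + t • (s - u), s + t • (s - u)) := rfl
    simp only [hg, this, hψd]
    have : s + t • (s - u) - u = (1 + t) • (s - u) := by module
    rw [this, norm_smul, mul_pow, Real.norm_eq_abs, sq_abs]
  rw [h4] at h3
  have h5 : HasDerivAt (fun t : ℝ => (1 + t) ^ 2 * ‖s - u‖ ^ 2) (2 * ‖s - u‖ ^ 2) 0 := by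
    have := ((((hasDerivAt_id (0 : ℝ)).const_add 1).pow 2).mul_const (‖s - u‖ ^ 2))
    simpa using this
  have h6 := h3.unique h5
  have : 0 < ‖s - u‖ := norm_pos_iff.mpr hsu
  have : 0 < ‖s - u‖ ^ 2 := by positivity
  linarith
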